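/- Let B be a smooth counital coalgebra over a field k. Then B satisfies the lifting property along arbitrary conilpotent extensions: for every conilpotent extension f : D₁ → D₂ of (not necessarily finite-dimensional) counital k-coalgebras and every coalgebra homomorphism g : D₁ → B, there exists a coalgebra homomorphism h : D₂ → B with h ∘ f = g. -/

import Mathlib

open scoped TensorProduct

/-- A bundled counital coalgebra over a field `k`. -/
structure CoalgCarrier (k : Type) [Field k] : Type 1 where
  carrier : Type
  [isAddCommGroup : AddCommGroup carrier]
  [isModule : Module k carrier]
  [isCoalgebra : Coalgebra k carrier]

attribute [instance] CoalgCarrier.isAddCommGroup CoalgCarrier.isModule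
  CoalgCarrier.isCoalgebra

/-- An injective coalgebra homomorphism `f : C → D` is a minimal conilpotent extension if
`Δ(D) ⊆ f(C) ⊗ D + D ⊗ f(C)` inside `D ⊗ D`. -/
def IsMinimalConilpotentExtension {k C D : Type} [Field k]
    [AddCommGroup C] [Module k C] [Coalgebra k C]
    [AddCommGroup D] [Module k D] [Coalgebra k D] (f : C →ₗc[k] D) : Prop :=
  Function.Injective f ∧
  ∀ x : D, Coalgebra.comul (R := k) x ∈
    LinearMap.range (TensorProduct.map f.toLinearMap (LinearMap.id : D →ₗ[k] D)) ⊔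
    LinearMap.range (TensorProduct.map (LinearMap.id : D →ₗ[k] D) f.toLinearMap)

/-- `IsConilpotentChain k n C D f` says that `f` is a composition of `n + 1` minimal
conilpotent extensions. -/
def IsConilpotentChain (k : Type) [Field k] :
    ℕ → ∀ (C D : Type) [AddCommGroup C] [Module k C] [Coalgebra k C]
      [AddCommGroup D] [Module k D] [Coalgebra k D], (C →ₗc[k] D) → Prop
  | 0 => fun C D [AddCommGroup C] [Module k C] [Coalgebra k C]
      [AddCommGroup D] [Module k D] [Coalgebra k D] f => IsMinimalConilpotentExtension f
  | n + 1 => fun C D [AddCommGroup C] [Module k C] [Coalgebra k C]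
      [AddCommGroup D] [Module k D] [Coalgebra k D] f =>
      ∃ (E : CoalgCarrier k) (g : C →ₗc[k] E.carrier) (h : E.carrier →ₗc[k] D),
        IsConilpotentChain k n C E.carrier g ∧ IsMinimalConilpotentExtension h ∧
        f = h.comp g

/-- A conilpotent extension is a finite composition of minimal conilpotent extensions. -/
def IsConilpotentExtension {k C D : Type} [Field k]
    [AddCommGroup C] [Module k C] [Coalgebra k C]
    [AddCommGroup D] [Module k D] [Coalgebra k D] (f : C →ₗc[k] D) : Prop :=
  ∃ n : ℕ, IsConilpotentChain k n C D f

/-- A counital coalgebra `B` over `k` is smooth if it satisfies the lifting property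
along conilpotent extensions of finite-dimensional counital coalgebras. -/
def IsSmoothCoalgebra (k B : Type) [Field k]
    [AddCommGroup B] [Module k B] [Coalgebra k B] : Prop :=
  ∀ (C₁ C₂ : Type) [AddCommGroup C₁] [Module k C₁] [Coalgebra k C₁]
    [AddCommGroup C₂] [Module k C₂] [Coalgebra k C₂],
    FiniteDimensional k C₁ → FiniteDimensional k C₂ →
    ∀ f : C₁ →ₗc[k] C₂, IsConilpotentExtension f →
      ∀ g : C₁ →ₗc[k] B, ∃ h : C₂ →ₗc[k] B, h.comp f = g

namespace TensorProduct

variable {k M N P Q : Type*} [Field k] [AddCommGroup M] [Module k M] [AddCommGroup N] [Module k N]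
  [AddCommGroup P] [Module k P] [AddCommGroup Q] [Module k Q]

/-- Contraction of the left tensor factor with a functional. -/
noncomputable def contractLeftWith (φ : M →ₗ[k] k) : M ⊗[k] N →ₗ[k] N :=
  TensorProduct.lid k N ∘ₗ φ.rTensor N

/-- Contraction of the right tensor factor with a functional. -/
noncomputable def contractRightWith (φ : N →ₗ[k] k) : M ⊗[k] N →ₗ[k] M :=
  TensorProduct.rid k M ∘ₗ φ.lTensor M

@[simp]
theorem contractLeftWith_tmul (φ : M →ₗ[k] k) (m : M) (n : N) :
    contractLeftWith φ (m ⊗ₜ[k] n) = φ m • n := by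
  simp [contractLeftWith]

@[simp]
theorem contractRightWith_tmul (φ : N →ₗ[k] k) (m : M) (n : N) :
    contractRightWith φ (m ⊗ₜ[k] n) = φ n • m := by
  simp [contractRightWith]

theorem contractLeftWith_map (φ : P →ₗ[k] k) (f : M →ₗ[k] P) (g : N →ₗ[k] Q) (t : M ⊗[k] N) :
    contractLeftWith φ (map f g t) = g (contractLeftWith (φ ∘ₗ f) t) := by
  induction t with
  | zero => simp
  | tmul m n => simp
  | add s t hs ht => simp only [map_add, hs, ht]

theorem contractRightWith_map (φ : Q →ₗ[k] k) (f : M →ₗ[k] P) (g : N →ₗ[k] Q) (t : M ⊗[k] N) :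
    contractRightWith φ (map f g t) = f (contractRightWith (φ ∘ₗ g) t) := by
  induction t with
  | zero => simp
  | tmul m n => simp
  | add s t hs ht => simp only [map_add, hs, ht]

theorem eq_zero_of_contractLeftWith {t : M ⊗[k] N}
    (h : ∀ φ : M →ₗ[k] k, contractLeftWith φ t = 0) : t = 0 := by
  classical
  let b := Module.Basis.ofVectorSpace k M
  apply (equivFinsuppOfBasisLeft (N := N) b).injective
  rw [map_zero]
  ext i
  have key : ∀ s : M ⊗[k] N, equivFinsuppOfBasisLeft b s i = contractLeftWith (b.coord i) s := by
    intro s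
    induction s with
    | zero => simp
    | tmul m n => simp
    | add s t hs ht => simp only [map_add, Finsupp.add_apply, hs, ht]
  rw [key, h]
  rfl

theorem eq_zero_of_contractRightWith {t : M ⊗[k] N}
    (h : ∀ φ : N →ₗ[k] k, contractRightWith φ t = 0) : t = 0 := by
  apply (TensorProduct.comm k M N).injective
  rw [map_zero]
  apply eq_zero_of_contractLeftWith
  intro φ
  rw [← h φ]
  clear h
  induction t with
  | zero => simp
  | tmul m n => simp
  | add s t hs ht => simp only [map_add, hs, ht]

/-- A projection onto `V` applied to both factors fixes every tensor whose contractions lie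
in `V`. -/
theorem map_map_eq_self_of_contract_mem {V : Submodule k M} {π : M →ₗ[k] V}
    (hπ : π ∘ₗ V.subtype = LinearMap.id) {t : M ⊗[k] M}
    (h : ∀ φ : M →ₗ[k] k, contractLeftWith φ t ∈ V ∧ contractRightWith φ t ∈ V) :
    map V.subtype V.subtype (map π π t) = t := by
  have fix : ∀ v ∈ V, (π v : M) = v := fun v hv =>
    congrArg Subtype.val (LinearMap.congr_fun hπ ⟨v, hv⟩)
  have hl : map LinearMap.id (V.subtype ∘ₗ π) t = t := by
    rw [← sub_eq_zero]
    refine eq_zero_of_contractLeftWith fun φ => ?_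
    rw [map_sub, contractLeftWith_map, sub_eq_zero]
    exact fix _ (h φ).1
  have hr : map (V.subtype ∘ₗ π) LinearMap.id t = t := by
    rw [← sub_eq_zero]
    refine eq_zero_of_contractRightWith fun φ => ?_
    rw [map_sub, contractRightWith_map, sub_eq_zero]
    exact fix _ (h φ).2
  conv_rhs => rw [← hr, ← hl]
  simp only [← LinearMap.comp_apply, ← map_comp, LinearMap.comp_id, LinearMap.id_comp]

theorem fg_contractLeftWith (t : M ⊗[k] N) :
    ∃ S : Submodule k N, S.FG ∧ ∀ φ : M →ₗ[k] k, contractLeftWith φ t ∈ S := by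
  induction t with
  | zero => exact ⟨⊥, Submodule.fg_bot, by simp⟩
  | tmul m n =>
    exact ⟨k ∙ n, Submodule.fg_span_singleton n, fun φ => by
      simpa using Submodule.smul_mem _ _ (Submodule.mem_span_singleton_self n)⟩
  | add s t hs ht =>
    obtain ⟨S, hS, hs⟩ := hs
    obtain ⟨T, hT, ht⟩ := ht
    exact ⟨S ⊔ T, hS.sup hT, fun φ => by
      rw [map_add]; exact Submodule.add_mem_sup (hs φ) (ht φ)⟩

theorem fg_contractRightWith (t : M ⊗[k] N) :
    ∃ S : Submodule k M, S.FG ∧ ∀ φ : N →ₗ[k] k, contractRightWith φ t ∈ S := by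
  induction t with
  | zero => exact ⟨⊥, Submodule.fg_bot, by simp⟩
  | tmul m n =>
    exact ⟨k ∙ m, Submodule.fg_span_singleton m, fun φ => by
      simpa using Submodule.smul_mem _ _ (Submodule.mem_span_singleton_self m)⟩
  | add s t hs ht =>
    obtain ⟨S, hS, hs⟩ := hs
    obtain ⟨T, hT, ht⟩ := ht
    exact ⟨S ⊔ T, hS.sup hT, fun φ => by
      rw [map_add]; exact Submodule.add_mem_sup (hs φ) (ht φ)⟩

end TensorProduct

namespace Coalgebra

open _root_.TensorProduct

variable {k D : Type*} [Field k] [AddCommGroup D] [Module k D] [Coalgebra k D]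

/-- The operator `x ↦ ∑ φ(x₁) x₂` on a coalgebra. -/
noncomputable def leftHit (φ : D →ₗ[k] k) : D →ₗ[k] D := contractLeftWith φ ∘ₗ comul

/-- The operator `x ↦ ∑ φ(x₂) x₁` on a coalgebra. -/
noncomputable def rightHit (φ : D →ₗ[k] k) : D →ₗ[k] D := contractRightWith φ ∘ₗ comul

@[simp]
theorem leftHit_counit (x : D) : leftHit (k := k) counit x = x := by
  simp [leftHit, contractLeftWith]

@[simp]
theorem rightHit_counit (x : D) : rightHit (k := k) counit x = x := by
  simp [rightHit, contractRightWith]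

theorem leftHit_leftHit (φ ψ : D →ₗ[k] k) (x : D) :
    leftHit φ (leftHit ψ x) = leftHit (_root_.TensorProduct.lid k k ∘ₗ map ψ φ ∘ₗ comul) x := by
  have h₁ : ∀ t : D ⊗[k] D, leftHit φ (contractLeftWith ψ t) =
      contractLeftWith (_root_.TensorProduct.lid k k ∘ₗ map ψ φ)
        ((_root_.TensorProduct.assoc k D D D).symm (comul.lTensor D t)) := by
    intro t
    induction t with
    | zero => simp
    | add s t hs ht => simp only [map_add, hs, ht]
    | tmul a b =>
      simp only [leftHit, LinearMap.comp_apply, contractLeftWith_tmul, map_smul,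
        LinearMap.lTensor_tmul]
      induction comul (R := k) b with
      | zero => simp
      | add s t hs ht => simp only [map_add, tmul_add, smul_add, hs, ht]
      | tmul b c => simp [mul_smul]
  rw [show leftHit ψ x = contractLeftWith ψ (comul x) from rfl, h₁, coassoc_symm_apply]
  exact contractLeftWith_map (N := D) _ _ LinearMap.id _

theorem rightHit_rightHit (φ ψ : D →ₗ[k] k) (x : D) :
    rightHit φ (rightHit ψ x) = rightHit (_root_.TensorProduct.lid k k ∘ₗ map φ ψ ∘ₗ comul) x := by
  have h₁ : ∀ t : D ⊗[k] D, rightHit φ (contractRightWith ψ t) =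
      contractRightWith (_root_.TensorProduct.lid k k ∘ₗ map φ ψ)
        (_root_.TensorProduct.assoc k D D D (comul.rTensor D t)) := by
    intro t
    induction t with
    | zero => simp
    | add s t hs ht => simp only [map_add, hs, ht]
    | tmul a b =>
      simp only [rightHit, LinearMap.comp_apply, contractRightWith_tmul, map_smul,
        LinearMap.rTensor_tmul]
      induction comul (R := k) a with
      | zero => simp
      | add s t hs ht => simp only [map_add, add_tmul, smul_add, hs, ht]
      | tmul a c => simp [smul_smul, mul_comm]
  rw [show rightHit ψ x = contractRightWith ψ (comul x) from rfl, h₁, coassoc_apply]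
  exact contractRightWith_map (M := D) _ LinearMap.id _ _

theorem rightHit_leftHit (φ ψ : D →ₗ[k] k) (x : D) :
    rightHit φ (leftHit ψ x) = leftHit ψ (rightHit φ x) := by
  have h₁ : ∀ t : D ⊗[k] D, rightHit φ (contractLeftWith ψ t) =
      contractLeftWith ψ (contractRightWith φ
        ((_root_.TensorProduct.assoc k D D D).symm (comul.lTensor D t))) := by
    intro t
    induction t with
    | zero => simp
    | add s t hs ht => simp only [map_add, hs, ht]
    | tmul a b =>
      simp only [rightHit, LinearMap.comp_apply, contractLeftWith_tmul, map_smul,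
        LinearMap.lTensor_tmul]
      induction comul (R := k) b with
      | zero => simp
      | add s t hs ht => simp only [map_add, tmul_add, smul_add, hs, ht]
      | tmul b c => simp [smul_smul, mul_comm]
  rw [show leftHit ψ x = contractLeftWith ψ (comul x) from rfl, h₁, coassoc_symm_apply]
  exact congrArg _ (contractRightWith_map (N := D) _ _ LinearMap.id _)

/-- A subspace of a coalgebra is a subcoalgebra if it is stable under contracting either factor
of the comultiplication. -/
def IsSubcoalgebra (V : Submodule k D) : Prop :=
  ∀ x ∈ V, ∀ φ : D →ₗ[k] k, leftHit φ x ∈ V ∧ rightHit φ x ∈ V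

theorem IsSubcoalgebra.inf {V W : Submodule k D} (hV : IsSubcoalgebra V) (hW : IsSubcoalgebra W) :
    IsSubcoalgebra (V ⊓ W) := fun x hx φ =>
  ⟨⟨(hV x hx.1 φ).1, (hW x hx.2 φ).1⟩, ⟨(hV x hx.1 φ).2, (hW x hx.2 φ).2⟩⟩

/-- Every element of a coalgebra lies in a finite-dimensional subcoalgebra. -/
theorem exists_fg_isSubcoalgebra (x : D) :
    ∃ V : Submodule k D, IsSubcoalgebra V ∧ V.FG ∧ x ∈ V := by
  let V : Submodule k D := Submodule.span k {y | ∃ φ ψ : D →ₗ[k] k, y = leftHit φ (rightHit ψ x)}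
  refine ⟨V, fun y hy χ => ?_, ?_, Submodule.subset_span ⟨counit, counit, by simp⟩⟩
  · induction hy using Submodule.span_induction with
    | zero => simp
    | add a b _ _ ha hb =>
      simp only [map_add]
      exact ⟨add_mem ha.1 hb.1, add_mem ha.2 hb.2⟩
    | smul c a _ ha =>
      simp only [map_smul]
      exact ⟨V.smul_mem c ha.1, V.smul_mem c ha.2⟩
    | mem y hy =>
      obtain ⟨φ, ψ, rfl⟩ := hy
      rw [leftHit_leftHit, rightHit_leftHit, rightHit_rightHit]
      exact ⟨Submodule.subset_span ⟨_, _, rfl⟩, Submodule.subset_span ⟨_, _, rfl⟩⟩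
  · obtain ⟨S, ⟨T, rfl⟩, hS⟩ := fg_contractRightWith (comul (R := k) x)
    choose L hL hLmem using fun y : D => fg_contractLeftWith (comul (R := k) y)
    have hfg : (⨆ y ∈ T, L y).FG := Submodule.fg_biSup T L fun y _ => hL y
    refine Submodule.FG.of_le hfg (Submodule.span_le.2 ?_)
    rintro _ ⟨φ, ψ, rfl⟩
    have h : Submodule.span k (T : Set D) ≤ (⨆ y ∈ T, L y).comap (leftHit φ) :=
      Submodule.span_le.2 fun y hy =>
        Submodule.mem_iSup_of_mem y (Submodule.mem_iSup_of_mem hy (hLmem y φ))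
    exact h (hS ψ)

end Coalgebra

namespace Coalgebra

open _root_.TensorProduct

section Subcoalgebra

variable {k D : Type*} [Field k] [AddCommGroup D] [Module k D] [Coalgebra k D]

/-- A subcoalgebra carries a coalgebra structure for which the inclusion is a homomorphism. -/
theorem IsSubcoalgebra.exists_coalgebra {V : Submodule k D} (hV : IsSubcoalgebra V) :
    ∃ _ : Coalgebra k V, (∀ v : V, counit (R := k) v = counit (R := k) (v : D)) ∧
      ∀ v : V, map V.subtype V.subtype (comul (R := k) v) = comul (R := k) (v : D) := by
  obtain ⟨π, hπ⟩ := V.subtype.exists_leftInverse_of_injective V.ker_subtype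
  let Δ : V →ₗ[k] V ⊗[k] V := map π π ∘ₗ comul ∘ₗ V.subtype
  let ε : V →ₗ[k] k := counit ∘ₗ V.subtype
  have hΔ : map V.subtype V.subtype ∘ₗ Δ = comul ∘ₗ V.subtype :=
    LinearMap.ext fun v => map_map_eq_self_of_contract_mem hπ (hV v v.2)
  have inj : Function.Injective V.subtype := V.subtype_injective
  refine ⟨{
    comul := Δ
    counit := ε
    coassoc := ?_
    rTensor_counit_comp_comul := ?_
    lTensor_counit_comp_comul := ?_ }, fun _ => rfl, LinearMap.congr_fun hΔ⟩
  · ext v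
    apply map_injective_of_flat_flat _ _ inj (map_injective_of_flat_flat _ _ inj inj)
    have h₁ : ∀ t : V ⊗[k] V, map V.subtype (map V.subtype V.subtype)
        (_root_.TensorProduct.assoc k V V V (Δ.rTensor V t)) =
        _root_.TensorProduct.assoc k D D D
          (comul.rTensor D (map V.subtype V.subtype t)) := by
      intro t
      have := LinearMap.congr_fun (map_map_comp_assoc_eq V.subtype V.subtype V.subtype)
        (Δ.rTensor V t)
      simp only [LinearMap.comp_apply, LinearEquiv.coe_coe] at this
      rw [this]
      simp only [LinearMap.rTensor, ← LinearMap.comp_apply, ← map_comp, hΔ,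
        LinearMap.id_comp, LinearMap.comp_id]
    have h₂ : ∀ t : V ⊗[k] V, map V.subtype (map V.subtype V.subtype) (Δ.lTensor V t) =
        comul.lTensor D (map V.subtype V.subtype t) := by
      intro t
      simp only [LinearMap.lTensor, ← LinearMap.comp_apply, ← map_comp, hΔ,
        LinearMap.id_comp, LinearMap.comp_id]
    have h₃ := LinearMap.congr_fun hΔ v
    simp only [LinearMap.comp_apply] at h₃
    simp only [LinearMap.comp_apply, LinearEquiv.coe_coe, h₁, h₂, h₃, coassoc_apply]
  · ext v
    apply map_injective_of_flat_flat (LinearMap.id : k →ₗ[k] k) _ Function.injective_id inj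
    have h₃ := LinearMap.congr_fun hΔ v
    simp only [LinearMap.comp_apply] at h₃
    have h₁ : ∀ t : V ⊗[k] V, map LinearMap.id V.subtype (ε.rTensor V t) =
        counit.rTensor D (map V.subtype V.subtype t) := by
      intro t
      simp only [LinearMap.rTensor, ← LinearMap.comp_apply, ← map_comp, ε,
        LinearMap.id_comp, LinearMap.comp_id]
    simp [h₁, h₃]
  · ext v
    apply map_injective_of_flat_flat _ (LinearMap.id : k →ₗ[k] k) inj Function.injective_id
    have h₃ := LinearMap.congr_fun hΔ v
    simp only [LinearMap.comp_apply] at h₃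
    have h₁ : ∀ t : V ⊗[k] V, map V.subtype LinearMap.id (ε.lTensor V t) =
        counit.lTensor D (map V.subtype V.subtype t) := by
      intro t
      simp only [LinearMap.lTensor, ← LinearMap.comp_apply, ← map_comp, ε,
        LinearMap.id_comp, LinearMap.comp_id]
    simp [h₁, h₃]

theorem isSubcoalgebra_of_forall_exists {V : Submodule k D}
    (h : ∀ v : V, ∃ t, map V.subtype V.subtype t = comul (R := k) (v : D)) :
    IsSubcoalgebra V := by
  intro x hx φ
  obtain ⟨t, ht⟩ := h ⟨x, hx⟩
  simp only [leftHit, rightHit, LinearMap.comp_apply, ← ht, contractLeftWith_map,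
    contractRightWith_map]
  exact ⟨Subtype.prop _, Subtype.prop _⟩

end Subcoalgebra

end Coalgebra

/-- If a subspace `E` contains the image of a minimal conilpotent extension `f : C → D`, then
intersecting with `E` gives minimal conilpotent extensions `V ⊓ E → V` of subcoalgebras. -/
theorem IsMinimalConilpotentExtension.of_le {k C D : Type} [Field k]
    [AddCommGroup C] [Module k C] [Coalgebra k C]
    [AddCommGroup D] [Module k D] [Coalgebra k D] {f : C →ₗc[k] D}
    (hf : IsMinimalConilpotentExtension f) {V E : Submodule k D}
    (hE : LinearMap.range f.toLinearMap ≤ E)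
    [Coalgebra k V] [Coalgebra k ↥(V ⊓ E)]
    (hV : ∀ v : V, TensorProduct.map V.subtype V.subtype (Coalgebra.comul (R := k) v) =
      Coalgebra.comul (R := k) (v : D))
    (i : ↥(V ⊓ E) →ₗc[k] V) (hi : i.toLinearMap = Submodule.inclusion inf_le_left) :
    IsMinimalConilpotentExtension i := by
  have hi' : ∀ w, i w = Submodule.inclusion inf_le_left w := LinearMap.congr_fun hi
  refine ⟨fun a b hab => ?_, fun v => ?_⟩
  · rw [hi', hi'] at hab
    exact Submodule.inclusion_injective _ hab
  let q : V →ₗ[k] D ⧸ E := E.mkQ ∘ₗ V.subtype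
  obtain ⟨s, hs⟩ := q.rangeRestrict.exists_rightInverse_of_surjective q.range_rangeRestrict
  obtain ⟨s', hs'⟩ := s.exists_extend
  let A : D →ₗ[k] V := s' ∘ₗ E.mkQ
  have hA : ∀ x ∈ E, A x = 0 := fun x hx => by
    simp [A, (Submodule.Quotient.mk_eq_zero E).2 hx]
  have hqA : ∀ v : V, q (A v) = q v := fun v => by
    have h₁ : A v = s (q.rangeRestrict v) := LinearMap.congr_fun hs' (q.rangeRestrict v)
    rw [h₁]
    exact congrArg Subtype.val (LinearMap.congr_fun hs (q.rangeRestrict v))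
  let σ : V →ₗ[k] V := A ∘ₗ V.subtype
  have hσE : ∀ v : V, ((LinearMap.id - σ : V →ₗ[k] V) v : D) ∈ E := fun v => by
    rw [← Submodule.Quotient.mk_eq_zero]
    change q ((LinearMap.id - σ : V →ₗ[k] V) v) = 0
    rw [LinearMap.sub_apply, map_sub]
    exact sub_eq_zero.2 (hqA v).symm
  let π : V →ₗ[k] ↥(V ⊓ E) :=
    LinearMap.codRestrict _ (V.subtype ∘ₗ (LinearMap.id - σ)) fun v => ⟨Subtype.prop _, hσE v⟩
  have hπ : i.toLinearMap ∘ₗ π = LinearMap.id - σ := by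
    ext v
    rw [hi]
    rfl
  have hAf : A ∘ₗ f.toLinearMap = 0 := LinearMap.ext fun c => hA _ (hE ⟨c, rfl⟩)
  have hzero : TensorProduct.map σ σ (Coalgebra.comul (R := k) v) = 0 := by
    rw [TensorProduct.map_comp, LinearMap.comp_apply, hV]
    obtain ⟨_, ⟨a, rfl⟩, _, ⟨b, rfl⟩, hab⟩ := Submodule.mem_sup.1 (hf.2 v)
    rw [← hab, map_add, ← LinearMap.comp_apply, ← LinearMap.comp_apply,
      ← TensorProduct.map_comp, ← TensorProduct.map_comp, hAf]
    simp
  refine Submodule.mem_sup.2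
    ⟨_, ⟨TensorProduct.map π LinearMap.id (Coalgebra.comul (R := k) v), rfl⟩,
    _, ⟨TensorProduct.map σ π (Coalgebra.comul (R := k) v), rfl⟩, ?_⟩
  have hsplit : ∀ t : V ⊗[k] V,
      TensorProduct.map (LinearMap.id - σ) LinearMap.id t +
        TensorProduct.map σ (LinearMap.id - σ) t + TensorProduct.map σ σ t = t := fun t => by
    induction t with
    | zero => simp
    | tmul a b => simp [TensorProduct.sub_tmul, TensorProduct.tmul_sub]
    | add a b ha hb => nth_rw 4 [← ha, ← hb]; simp only [map_add]; abel
  conv_rhs => rw [← hsplit (Coalgebra.comul v), hzero, add_zero, ← hπ]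
  rw [TensorProduct.map_map, TensorProduct.map_map]
  rfl

namespace LinearPMap

open _root_.TensorProduct Coalgebra

variable {k D B : Type*} [Field k] [AddCommGroup D] [Module k D]
  [AddCommGroup B] [Module k B]

/-- Tensors on the domain of `p` can be moved to the domain of an extension of `p`. -/
theorem exists_map_of_le {p q : D →ₗ.[k] B} (h : p ≤ q) (t : p.domain ⊗[k] p.domain) :
    ∃ s : q.domain ⊗[k] q.domain,
      map q.domain.subtype q.domain.subtype s = map p.domain.subtype p.domain.subtype t ∧
      map q.toFun q.toFun s = map p.toFun p.toFun t := by
  refine ⟨map (Submodule.inclusion h.1) (Submodule.inclusion h.1) t, ?_, ?_⟩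
  · rw [← LinearMap.comp_apply, ← map_comp, Submodule.subtype_comp_inclusion]
  · rw [← LinearMap.comp_apply, ← map_comp]
    have : q.toFun ∘ₗ Submodule.inclusion h.1 = p.toFun :=
      LinearMap.ext fun x => (apply_comp_inclusion h x).symm
    rw [this]

variable [Coalgebra k D] [Coalgebra k B]

/-- A partially defined linear map between coalgebras is a coalgebra homomorphism if its domain
is a subcoalgebra and it commutes with counit and comultiplication. -/
structure IsCoalgHom (p : D →ₗ.[k] B) : Prop where
  counit_apply : ∀ x : p.domain, counit (R := k) (p x) = counit (R := k) (x : D)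
  exists_comul : ∀ x : p.domain, ∃ t : p.domain ⊗[k] p.domain,
    map p.domain.subtype p.domain.subtype t = comul (R := k) (x : D) ∧
    map p.toFun p.toFun t = comul (R := k) (p x)

theorem IsCoalgHom.isSubcoalgebra {p : D →ₗ.[k] B} (hp : p.IsCoalgHom) :
    IsSubcoalgebra p.domain :=
  isSubcoalgebra_of_forall_exists fun v => (hp.exists_comul v).imp fun _ h => h.1

theorem IsCoalgHom.sSup {c : Set (D →ₗ.[k] B)} (hc : DirectedOn (· ≤ ·) c) (hne : c.Nonempty)
    (h : ∀ p ∈ c, p.IsCoalgHom) : (LinearPMap.sSup c hc).IsCoalgHom := by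
  have key : ∀ x : (LinearPMap.sSup c hc).domain, ∃ p ∈ c, ∃ y : p.domain,
      (y : D) = x ∧ p y = LinearPMap.sSup c hc x := fun x => by
    obtain ⟨p, hpc, hx⟩ := (mem_domain_sSup_iff hne hc).1 x.2
    exact ⟨p, hpc, ⟨x, hx⟩, rfl, (LinearPMap.le_sSup hc hpc).2 rfl⟩
  refine ⟨fun x => ?_, fun x => ?_⟩
  · obtain ⟨p, hpc, y, hy, hpy⟩ := key x
    rw [← hy, ← hpy, (h p hpc).counit_apply]
  · obtain ⟨p, hpc, y, hy, hpy⟩ := key x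
    obtain ⟨t, ht₁, ht₂⟩ := (h p hpc).exists_comul y
    obtain ⟨s, hs₁, hs₂⟩ := exists_map_of_le (LinearPMap.le_sSup hc hpc) t
    exact ⟨s, by rw [hs₁, ht₁, hy], by rw [hs₂, ht₂, hpy]⟩

theorem IsCoalgHom.sup {p q : D →ₗ.[k] B} (hp : p.IsCoalgHom) (hq : q.IsCoalgHom)
    (h : ∀ (x : p.domain) (y : q.domain), (x : D) = y → p x = q y) :
    (p.sup q h).IsCoalgHom := by
  have key : ∀ z : (p.sup q h).domain, ∃ (x : p.domain) (y : q.domain),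
      (z : D) = x + y ∧ p.sup q h z = p x + q y := fun z => by
    obtain ⟨x, hx, y, hy, hxy⟩ := Submodule.mem_sup.1 z.2
    exact ⟨⟨x, hx⟩, ⟨y, hy⟩, hxy.symm, sup_apply h _ _ _ hxy⟩
  refine ⟨fun z => ?_, fun z => ?_⟩
  · obtain ⟨x, y, hz, hpq⟩ := key z
    rw [hz, hpq, _root_.map_add, _root_.map_add, hp.counit_apply, hq.counit_apply]
  · obtain ⟨x, y, hz, hpq⟩ := key z
    obtain ⟨t, ht₁, ht₂⟩ := hp.exists_comul x
    obtain ⟨u, hu₁, hu₂⟩ := hq.exists_comul y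
    obtain ⟨t', ht₁', ht₂'⟩ := exists_map_of_le (p.left_le_sup q h) t
    obtain ⟨u', hu₁', hu₂'⟩ := exists_map_of_le (p.right_le_sup q h) u
    refine ⟨t' + u', ?_, ?_⟩
    · rw [_root_.map_add, ht₁', hu₁', ht₁, hu₁, hz, _root_.map_add]
    · rw [_root_.map_add, ht₂', hu₂', ht₂, hu₂, hpq, _root_.map_add]

/-- An everywhere defined `LinearPMap.IsCoalgHom` is a coalgebra homomorphism. -/
theorem IsCoalgHom.exists_coalgHom {p : D →ₗ.[k] B} (hp : p.IsCoalgHom) (htop : p.domain = ⊤) :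
    ∃ h : D →ₗc[k] B, ∀ x : p.domain, h x = p x := by
  let j : D →ₗ[k] p.domain := LinearMap.codRestrict _ LinearMap.id fun x => by simp [htop]
  have hj : j ∘ₗ p.domain.subtype = LinearMap.id := rfl
  refine ⟨{ p.toFun ∘ₗ j with
    counit_comp := LinearMap.ext fun x => hp.counit_apply (j x)
    map_comp_comul := LinearMap.ext fun x => ?_ }, fun x => rfl⟩
  obtain ⟨t, ht₁, ht₂⟩ := hp.exists_comul (j x)
  change map (p.toFun ∘ₗ j) (p.toFun ∘ₗ j) (comul x) = comul (p (j x))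
  rw [← ht₂, map_comp, LinearMap.comp_apply]
  change map _ _ (map j j (comul ((j x : p.domain) : D))) = _
  rw [← ht₁, ← LinearMap.comp_apply (map j j), ← map_comp, hj, map_id, LinearMap.id_apply]

/-- A coalgebra homomorphism, transported along an injective coalgebra homomorphism. -/
theorem exists_isCoalgHom_of_injective {C : Type*} [AddCommGroup C] [Module k C] [Coalgebra k C]
    (f : C →ₗc[k] D) (hf : Function.Injective f) (g : C →ₗc[k] B) :
    ∃ p : D →ₗ.[k] B, p.IsCoalgHom ∧ p.domain = LinearMap.range f.toLinearMap ∧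
      ∀ (x : p.domain) (c : C), (x : D) = f c → p x = g c := by
  let e := LinearEquiv.ofInjective f.toLinearMap hf
  let p : D →ₗ.[k] B := ⟨LinearMap.range f.toLinearMap, g.toLinearMap ∘ₗ e.symm.toLinearMap⟩
  have hpe : ∀ c, p (e c) = g c := fun c => congrArg g (e.symm_apply_apply c)
  have key : ∀ x : p.domain, ∃ c, x = e c := fun x => ⟨e.symm x, (e.apply_symm_apply x).symm⟩
  refine ⟨p, ⟨fun x => ?_, fun x => ?_⟩, rfl, fun x c hx => ?_⟩
  · obtain ⟨c, rfl⟩ := key x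
    rw [hpe, CoalgHomClass.counit_comp_apply]
    exact (CoalgHomClass.counit_comp_apply f c).symm
  · obtain ⟨c, rfl⟩ := key x
    refine ⟨map e.toLinearMap e.toLinearMap (comul c), ?_, ?_⟩
    · rw [← LinearMap.comp_apply, ← map_comp]
      exact CoalgHomClass.map_comp_comul_apply f c
    · rw [← LinearMap.comp_apply, ← map_comp, hpe]
      have : p.toFun ∘ₗ e.toLinearMap = g.toLinearMap := LinearMap.ext hpe
      rw [this]
      exact CoalgHomClass.map_comp_comul_apply g c
  · rw [show x = e c from Subtype.ext hx, hpe]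

end LinearPMap

section Lifting

open TensorProduct Coalgebra

variable {k B : Type} [Field k] [AddCommGroup B] [Module k B] [Coalgebra k B]
  {C D : Type} [AddCommGroup C] [Module k C] [Coalgebra k C]
  [AddCommGroup D] [Module k D] [Coalgebra k D]

/-- A partial homomorphism to a smooth coalgebra extends to any finite-dimensional
subcoalgebra. -/
theorem IsSmoothCoalgebra.exists_isCoalgHom_compatible (hB : IsSmoothCoalgebra k B)
    {f : C →ₗc[k] D} (hf : IsMinimalConilpotentExtension f) {p : D →ₗ.[k] B} (hp : p.IsCoalgHom)
    (hfp : LinearMap.range f.toLinearMap ≤ p.domain) {V : Submodule k D}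
    (hV : IsSubcoalgebra V) (hfg : V.FG) :
    ∃ q : D →ₗ.[k] B, q.IsCoalgHom ∧ q.domain = V ∧
      ∀ (x : p.domain) (y : q.domain), (x : D) = y → p x = q y := by
  obtain ⟨_, hεV, hΔV⟩ := hV.exists_coalgebra
  obtain ⟨_, hεW, hΔW⟩ := (hV.inf hp.isSubcoalgebra).exists_coalgebra
  have : FiniteDimensional k V := Module.Finite.iff_fg.2 hfg
  have : FiniteDimensional k ↥(V ⊓ p.domain) := Submodule.finiteDimensional_inf_left _ _
  let i : ↥(V ⊓ p.domain) →ₗ[k] V := Submodule.inclusion inf_le_left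
  let j : ↥(V ⊓ p.domain) →ₗ[k] p.domain := Submodule.inclusion inf_le_right
  let ι : ↥(V ⊓ p.domain) →ₗc[k] V :=
    { i with
      counit_comp := LinearMap.ext fun w => (hεV (i w)).trans (hεW w).symm
      map_comp_comul := LinearMap.ext fun w => by
        apply map_injective_of_flat_flat _ _ V.subtype_injective V.subtype_injective
        refine Eq.trans ?_ ((hΔW w).trans (hΔV (i w)).symm)
        simp only [← LinearMap.comp_apply, ← LinearMap.comp_assoc, ← map_comp]
        rfl }
  let g : ↥(V ⊓ p.domain) →ₗc[k] B :=
    { p.toFun ∘ₗ j with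
      counit_comp := LinearMap.ext fun w => (hp.counit_apply (j w)).trans (hεW w).symm
      map_comp_comul := LinearMap.ext fun w => by
        obtain ⟨t, ht₁, ht₂⟩ := hp.exists_comul (j w)
        refine Eq.trans ?_ ht₂
        have : map j j (comul w) = t := by
          apply map_injective_of_flat_flat _ _ p.domain.subtype_injective
            p.domain.subtype_injective
          rw [ht₁, ← LinearMap.comp_apply, ← map_comp]
          exact hΔW w
        rw [← this, ← LinearMap.comp_apply (map p.toFun p.toFun), ← map_comp]
        rfl }
  obtain ⟨h, hh⟩ := hB _ _ inferInstance inferInstance ι ⟨0, hf.of_le hfp hΔV ι rfl⟩ g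
  refine ⟨⟨V, h.toLinearMap⟩, ⟨fun x => ?_, fun x => ⟨comul x, hΔV x, ?_⟩⟩, rfl,
    fun x y hxy => ?_⟩
  · exact (CoalgHomClass.counit_comp_apply h x).trans (hεV x)
  · exact CoalgHomClass.map_comp_comul_apply h x
  · obtain ⟨x, hx⟩ := x
    obtain ⟨y, hy⟩ := y
    obtain rfl : x = y := hxy
    exact (DFunLike.congr_fun hh ⟨x, hy, hx⟩).symm

theorem IsSmoothCoalgebra.exists_lift_of_minimal (hB : IsSmoothCoalgebra k B)
    {f : C →ₗc[k] D} (hf : IsMinimalConilpotentExtension f) (g : C →ₗc[k] B) :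
    ∃ h : D →ₗc[k] B, h.comp f = g := by
  obtain ⟨p₀, hp₀, hdom, hp₀g⟩ := LinearPMap.exists_isCoalgHom_of_injective f hf.1 g
  obtain ⟨p, hle, hmax⟩ := zorn_le_nonempty₀ {p : D →ₗ.[k] B | p.IsCoalgHom}
    (fun c hc hchain y hy => ⟨LinearPMap.sSup c hchain.directedOn,
      LinearPMap.IsCoalgHom.sSup _ ⟨y, hy⟩ hc, fun z hz => LinearPMap.le_sSup _ hz⟩) p₀ hp₀
  have hp : p.IsCoalgHom := hmax.prop
  have htop : p.domain = ⊤ := by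
    refine eq_top_iff.2 fun x _ => ?_
    obtain ⟨V, hV, hfg, hxV⟩ := exists_fg_isSubcoalgebra (k := k) x
    obtain ⟨q, hq, rfl, hpq⟩ := hB.exists_isCoalgHom_compatible hf hp (hdom ▸ hle.1) hV hfg
    have := hmax.le_of_ge (hp.sup hq hpq) (p.left_le_sup q hpq)
    exact ((p.right_le_sup q hpq).trans this).1 hxV
  obtain ⟨h, hh⟩ := hp.exists_coalgHom htop
  refine ⟨h, CoalgHom.ext fun c => ?_⟩
  have hc : f c ∈ p₀.domain := hdom ▸ LinearMap.mem_range_self f.toLinearMap c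
  rw [← hp₀g ⟨f c, hc⟩ c rfl, hle.2 (y := ⟨f c, hle.1 hc⟩) rfl]
  exact hh ⟨f c, hle.1 hc⟩

theorem IsSmoothCoalgebra.exists_lift_of_chain (hB : IsSmoothCoalgebra k B) (n : ℕ) :
    ∀ (C D : Type) [AddCommGroup C] [Module k C] [Coalgebra k C]
      [AddCommGroup D] [Module k D] [Coalgebra k D] (f : C →ₗc[k] D),
      IsConilpotentChain k n C D f → ∀ g : C →ₗc[k] B, ∃ h : D →ₗc[k] B, h.comp f = g := by
  induction n with
  | zero => exact fun C D _ _ _ _ _ _ f hf g => hB.exists_lift_of_minimal hf g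
  | succ n ih =>
    rintro C D _ _ _ _ _ _ _ ⟨E, u, v, hu, hv, rfl⟩ g
    obtain ⟨h₁, rfl⟩ := ih _ _ u hu g
    obtain ⟨h₂, rfl⟩ := hB.exists_lift_of_minimal hv h₁
    exact ⟨h₂, rfl⟩

end Lifting

/-- **A smooth coalgebra satisfies the lifting property along arbitrary conilpotent
extensions**: if `B` is smooth, `f : D₁ → D₂` is a conilpotent extension of (not
necessarily finite-dimensional) counital coalgebras and `g : D₁ → B` is a coalgebra
homomorphism, then there is a coalgebra homomorphism `h : D₂ → B` with `h ∘ f = g`. -/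
theorem smooth_lifts_along_arbitrary_conilpotent_extensions
    (k B : Type) [Field k] [AddCommGroup B] [Module k B] [Coalgebra k B]
    (hB : IsSmoothCoalgebra k B)
    (D₁ D₂ : Type) [AddCommGroup D₁] [Module k D₁] [Coalgebra k D₁]
    [AddCommGroup D₂] [Module k D₂] [Coalgebra k D₂]
    (f : D₁ →ₗc[k] D₂) (hf : IsConilpotentExtension f)
    (g : D₁ →ₗc[k] B) :
    ∃ h : D₂ →ₗc[k] B, h.comp f = g := by
  obtain ⟨n, hn⟩ := hf
  exact hB.exists_lift_of_chain n D₁ D₂ f hn g
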